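/- Let A, B, C, D be jointly distributed discrete random variables taking finitely many values in a field (or a ring with no zero divisors), none of which ever takes the value 0. Then H(AB − CD) + H(AB, CD, A(B+D), (A+C)D) ≤ H(AB, CD) + H(A(B+D), (A+C)D). If A, B, C, D are i.i.d., then H(AB − CD) ≤ 5 H(AB) + 2 H(A + B) − 6 H(A). -/

import Mathlib

/-- The probability of the event `E` under the probability mass function `p`
on a finite sample space. -/
noncomputable def prob {Ω : Type*} [Fintype Ω] (p : Ω → ℝ) (E : Set Ω) : ℝ :=
  ∑ ω, E.indicator p ω

/-- The Shannon entropy (base 2) of the discrete random variable `X` on the finite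
probability space given by the probability mass function `p`. -/
noncomputable def ent {Ω S : Type*} [Fintype Ω] (p : Ω → ℝ) (X : Ω → S) : ℝ :=
  letI := Classical.decEq S
  ∑ v ∈ Finset.univ.image X,
      -(prob p {ω | X ω = v} * Real.logb 2 (prob p {ω | X ω = v}))

open Finset in
lemma prob_eq_sum_ite {Ω : Type*} [Fintype Ω] (p : Ω → ℝ) (E : Set Ω) [DecidablePred (· ∈ E)] :
    prob p E = ∑ ω, if ω ∈ E then p ω else 0 := by
  unfold prob
  refine Finset.sum_congr rfl fun ω _ => ?_
  rw [Set.indicator_apply]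

lemma prob_nonneg' {Ω : Type*} [Fintype Ω] {p : Ω → ℝ} (hp : ∀ ω, 0 ≤ p ω) (E : Set Ω) :
    0 ≤ prob p E :=
  Finset.sum_nonneg fun ω _ => Set.indicator_nonneg (fun x _ => hp x) ω

lemma le_prob {Ω : Type*} [Fintype Ω] {p : Ω → ℝ} (hp : ∀ ω, 0 ≤ p ω) (E : Set Ω) {ω : Ω}
    (h : ω ∈ E) : p ω ≤ prob p E := by
  unfold prob
  have := Finset.single_le_sum (f := fun ω => E.indicator p ω) (s := Finset.univ)
    (fun ω _ => Set.indicator_nonneg (fun x _ => hp x) ω) (Finset.mem_univ ω)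
  simpa [Set.indicator_of_mem h] using this

/-- Marginalisation. -/
lemma prob_marg {Ω S : Type*} [Fintype Ω] (p : Ω → ℝ) (X : Ω → S) (T : Finset S)
    (hT : ∀ ω, X ω ∈ T) (E : Set Ω) : ∑ v ∈ T, prob p {ω | ω ∈ E ∧ X ω = v} = prob p E := by
  classical
  unfold prob
  rw [Finset.sum_comm]
  refine Finset.sum_congr rfl fun ω _ => ?_
  rw [Finset.sum_eq_single (X ω)]
  · by_cases h : ω ∈ E <;> simp [Set.indicator_apply, h]
  · intro b _ hb
    simp [Set.indicator_apply, hb.symm]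
  · intro h; exact absurd (hT ω) h

lemma ent_eq_finset {Ω S : Type*} [Fintype Ω] (p : Ω → ℝ) (X : Ω → S) (T : Finset S)
    (hT : ∀ ω, X ω ∈ T) :
    ent p X = ∑ v ∈ T, -(prob p {ω | X ω = v} * Real.logb 2 (prob p {ω | X ω = v})) := by
  classical
  unfold ent
  refine (Finset.sum_congr (by congr!) fun _ _ => rfl).trans
    (Finset.sum_subset (s₁ := Finset.univ.image X) ?_ ?_)
  · intro v hv
    obtain ⟨ω, -, rfl⟩ := Finset.mem_image.1 hv
    exact hT ω
  · intro v _ hv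
    have : {ω | X ω = v} = ∅ := by
      ext ω
      simp only [Set.mem_ofPred_eq, Set.mem_empty_iff_false, iff_false]
      rintro rfl
      exact hv (Finset.mem_image_of_mem _ (Finset.mem_univ _))
    simp [this, prob]

lemma ent_congr_law {Ω S : Type*} [Fintype Ω] (p : Ω → ℝ) (X Y : Ω → S)
    (h : ∀ v, prob p {ω | X ω = v} = prob p {ω | Y ω = v}) : ent p X = ent p Y := by
  classical
  rw [ent_eq_finset p X (Finset.univ.image X ∪ Finset.univ.image Y) (by intro ω; simp),
    ent_eq_finset p Y (Finset.univ.image X ∪ Finset.univ.image Y) (by intro ω; simp)]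
  exact Finset.sum_congr rfl fun v _ => by rw [h]

lemma ent_eq_sum {Ω S : Type*} [Fintype Ω] (p : Ω → ℝ) (X : Ω → S) :
    ent p X = -∑ ω, p ω * Real.logb 2 (prob p {ω' | X ω' = X ω}) := by
  classical
  rw [ent_eq_finset p X (Finset.univ.image X) (by intro ω; simp), Finset.sum_neg_distrib]
  congr 1
  rw [← Finset.sum_fiberwise_of_maps_to (s := Finset.univ) (t := Finset.univ.image X) (g := X)
    (by intro ω _; simp)]
  refine Finset.sum_congr rfl fun v _ => ?_
  rw [prob_eq_sum_ite p {ω | X ω = v}, Finset.sum_mul, Finset.sum_filter]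
  refine Finset.sum_congr rfl fun ω _ => ?_
  by_cases h : X ω = v
  · simp only [Set.mem_ofPred_eq, h, if_true]
    rw [prob_eq_sum_ite p {ω | X ω = v}]
    rfl
  · simp [h]

/-- General submodularity. -/
lemma submod {Ω S₁ S₂ S₃ S₄ : Type*} [Fintype Ω] {p : Ω → ℝ} (hp : ∀ ω, 0 ≤ p ω)
    (hp1 : ∑ ω, p ω = 1) (W : Ω → S₁) (Z : Ω → S₂) (X : Ω → S₃) (Y : Ω → S₄)
    (hX : ∀ ω ω', p ω ≠ 0 → p ω' ≠ 0 → X ω = X ω' → Z ω = Z ω')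
    (hY : ∀ ω ω', p ω ≠ 0 → p ω' ≠ 0 → Y ω = Y ω' → Z ω = Z ω')
    (hW : ∀ ω ω', p ω ≠ 0 → p ω' ≠ 0 → X ω = X ω' → Y ω = Y ω' → W ω = W ω') :
    ent p W + ent p Z ≤ ent p X + ent p Y := by
  classical
  rw [ent_eq_sum, ent_eq_sum, ent_eq_sum, ent_eq_sum]
  set qW := fun ω => prob p {ω' | W ω' = W ω} with hqW
  set qZ := fun ω => prob p {ω' | Z ω' = Z ω} with hqZ
  set qX := fun ω => prob p {ω' | X ω' = X ω} with hqX
  set qY := fun ω => prob p {ω' | Y ω' = Y ω} with hqY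
  have pos : ∀ ω, p ω ≠ 0 → 0 < p ω := fun ω h => lt_of_le_of_ne (hp ω) h.symm
  have pW : ∀ ω, p ω ≠ 0 → 0 < qW ω := fun ω h => (pos ω h).trans_le (le_prob hp _ rfl)
  have pZ : ∀ ω, p ω ≠ 0 → 0 < qZ ω := fun ω h => (pos ω h).trans_le (le_prob hp _ rfl)
  have pX : ∀ ω, p ω ≠ 0 → 0 < qX ω := fun ω h => (pos ω h).trans_le (le_prob hp _ rfl)
  have pY : ∀ ω, p ω ≠ 0 → 0 < qY ω := fun ω h => (pos ω h).trans_le (le_prob hp _ rfl)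
  have nW : ∀ ω, 0 ≤ qW ω := fun ω => prob_nonneg' hp _
  have nZ : ∀ ω, 0 ≤ qZ ω := fun ω => prob_nonneg' hp _
  have key : ∑ ω, p ω * (qX ω * qY ω / (qW ω * qZ ω)) ≤ 1 := by
    have e1 : ∀ ω, p ω * (qX ω * qY ω / (qW ω * qZ ω)) = ∑ a, ∑ b,
        (p a * p b) * (if X a = X ω ∧ Y b = Y ω then p ω / (qW ω * qZ ω) else 0) := by
      intro ω
      have : qX ω * qY ω = ∑ a, ∑ b, (if X a = X ω then p a else 0) *
          (if Y b = Y ω then p b else 0) := by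
        rw [← Finset.sum_mul_sum]
        simp only [hqX, hqY]
        rw [prob_eq_sum_ite, prob_eq_sum_ite]
        rfl
      rw [mul_div_left_comm, this, Finset.sum_mul]
      refine Finset.sum_congr rfl fun a _ => ?_
      rw [Finset.sum_mul]
      refine Finset.sum_congr rfl fun b _ => ?_
      by_cases h1 : X a = X ω <;> by_cases h2 : Y b = Y ω <;> simp [h1, h2]
    have e2 : ∀ a b, ∑ ω, (p a * p b) *
        (if X a = X ω ∧ Y b = Y ω then p ω / (qW ω * qZ ω) else 0) ≤
        p a * ((if Z b = Z a then p b else 0) / qZ a) := by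
      intro a b
      have nn : 0 ≤ p a * ((if Z b = Z a then p b else 0) / qZ a) := by
        refine mul_nonneg (hp a) (div_nonneg ?_ (nZ a))
        split_ifs
        exacts [hp b, le_rfl]
      by_cases ha : p a = 0
      · simp [ha]
      by_cases hb : p b = 0
      · simp [hb]
      by_cases hex : ∃ ω₀, p ω₀ ≠ 0 ∧ X a = X ω₀ ∧ Y b = Y ω₀
      · obtain ⟨o, ho, ox, oy⟩ := hex
        have zab : Z b = Z a := (hY _ _ hb ho oy).trans (hX _ _ ha ho ox).symm
        rw [if_pos zab, ← Finset.mul_sum, mul_assoc]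
        refine mul_le_mul_of_nonneg_left ?_ (hp a)
        rw [div_eq_mul_inv]
        refine mul_le_mul_of_nonneg_left ?_ (hp b)
        calc ∑ ω, (if X a = X ω ∧ Y b = Y ω then p ω / (qW ω * qZ ω) else 0)
            ≤ ∑ ω, (if W ω = W o then p ω else 0) * ((qW o)⁻¹ * (qZ a)⁻¹) := by
              refine Finset.sum_le_sum fun ω _ => ?_
              by_cases hω : p ω = 0
              · simp [hω]
              split_ifs with h1 h2 h2
              · have hz : Z a = Z ω := hX _ _ ha hω h1.1
                simp only [hqW, hqZ, h2, hz]
                rw [div_eq_mul_inv, mul_inv]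
              · exact absurd (hW _ _ hω ho (h1.1.symm.trans ox) (h1.2.symm.trans oy)) h2
              · exact mul_nonneg (hp ω) (mul_nonneg (inv_nonneg.2 (nW o)) (inv_nonneg.2 (nZ a)))
              · simp
          _ = (qZ a)⁻¹ := by
              rw [← Finset.sum_mul]
              have : ∑ ω, (if W ω = W o then p ω else 0) = qW o := by
                simp only [hqW]
                rw [prob_eq_sum_ite]
                rfl
              rw [this, ← mul_assoc, mul_inv_cancel₀ (pW o ho).ne', one_mul]
      · refine le_trans (le_of_eq (Finset.sum_eq_zero fun ω _ => ?_)) nn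
        by_cases hω : p ω = 0
        · simp [hω]
        · rw [if_neg (fun h => hex ⟨ω, hω, h⟩), mul_zero]
    calc ∑ ω, p ω * (qX ω * qY ω / (qW ω * qZ ω))
        = ∑ a, ∑ b, ∑ ω, (p a * p b) *
          (if X a = X ω ∧ Y b = Y ω then p ω / (qW ω * qZ ω) else 0) := by
          rw [Finset.sum_congr rfl fun ω _ => e1 ω, Finset.sum_comm]
          exact Finset.sum_congr rfl fun a _ => Finset.sum_comm
      _ ≤ ∑ a, ∑ b, p a * ((if Z b = Z a then p b else 0) / qZ a) :=
          Finset.sum_le_sum fun a _ => Finset.sum_le_sum fun b _ => e2 a b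
      _ = ∑ a, p a := by
          refine Finset.sum_congr rfl fun a _ => ?_
          rw [← Finset.mul_sum, ← Finset.sum_div]
          by_cases ha : p a = 0
          · simp [ha]
          have : ∑ b, (if Z b = Z a then p b else 0) = qZ a := by
            simp only [hqZ]
            rw [prob_eq_sum_ite]
            rfl
          rw [this, div_self (pZ a ha).ne', mul_one]
      _ = 1 := hp1
  have l2 : 0 < Real.log 2 := Real.log_pos (by norm_num)
  have pt : ∀ ω, p ω * Real.logb 2 (qX ω) + p ω * Real.logb 2 (qY ω) -
      p ω * Real.logb 2 (qW ω) - p ω * Real.logb 2 (qZ ω) ≤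
      (p ω * (qX ω * qY ω / (qW ω * qZ ω)) - p ω) / Real.log 2 := by
    intro ω
    by_cases hω : p ω = 0
    · simp [hω]
    have x := pX ω hω
    have y := pY ω hω
    have w := pW ω hω
    have z := pZ ω hω
    have := Real.log_le_sub_one_of_pos (div_pos (mul_pos x y) (mul_pos w z))
    rw [Real.log_div (by positivity) (by positivity), Real.log_mul x.ne' y.ne',
      Real.log_mul w.ne' z.ne'] at this
    rw [le_div_iff₀ l2]
    simp only [Real.logb]
    have h3 := mul_le_mul_of_nonneg_left this (hp ω)
    field_simp at h3 ⊢
    linarith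
  have tot := Finset.sum_le_sum fun ω (_ : ω ∈ Finset.univ) => pt ω
  rw [← Finset.sum_div, Finset.sum_sub_distrib, Finset.sum_sub_distrib, Finset.sum_sub_distrib,
    Finset.sum_add_distrib, hp1] at tot
  have : (∑ ω, p ω * (qX ω * qY ω / (qW ω * qZ ω)) - 1) / Real.log 2 ≤ 0 :=
    div_nonpos_of_nonpos_of_nonneg (by linarith) l2.le
  linarith

lemma ent_unit {Ω : Type*} [Fintype Ω] {p : Ω → ℝ} (hp1 : ∑ ω, p ω = 1) :
    ent p (fun _ => ()) = 0 := by
  rw [ent_eq_sum]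
  simp [prob, hp1]

/-- Subadditivity, with a variable determined by two others. -/
lemma subadd {Ω S₁ S₃ S₄ : Type*} [Fintype Ω] {p : Ω → ℝ} (hp : ∀ ω, 0 ≤ p ω)
    (hp1 : ∑ ω, p ω = 1) (W : Ω → S₁) (X : Ω → S₃) (Y : Ω → S₄)
    (hW : ∀ ω ω', p ω ≠ 0 → p ω' ≠ 0 → X ω = X ω' → Y ω = Y ω' → W ω = W ω') :
    ent p W ≤ ent p X + ent p Y := by
  have := submod hp hp1 W (fun _ => ()) X Y (by simp) (by simp) hW
  rw [ent_unit hp1] at this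
  linarith

lemma pair_law {Ω R : Type*} [Fintype Ω] {p : Ω → ℝ} (hp1 : ∑ ω, p ω = 1) {A B C D : Ω → R}
    (h : ∀ a b c d : R, prob p {ω | A ω = a ∧ B ω = b ∧ C ω = c ∧ D ω = d} =
        prob p {ω | A ω = a} * prob p {ω | B ω = b} * prob p {ω | C ω = c} *
          prob p {ω | D ω = d}) (a b : R) :
    prob p {ω | A ω = a ∧ B ω = b} = prob p {ω | A ω = a} * prob p {ω | B ω = b} := by
  classical
  have one : ∀ X : Ω → R, ∑ v ∈ Finset.univ.image X, prob p {ω | X ω = v} = 1 := by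
    intro X
    have := prob_marg p X (Finset.univ.image X) (by simp) Set.univ
    simpa [prob, hp1] using this
  rw [← prob_marg p C (Finset.univ.image C) (by simp)]
  have : ∀ c, prob p {ω | ω ∈ {ω | A ω = a ∧ B ω = b} ∧ C ω = c} =
      prob p {ω | A ω = a} * prob p {ω | B ω = b} * prob p {ω | C ω = c} := by
    intro c
    rw [← prob_marg p D (Finset.univ.image D) (by simp)]
    calc _ = ∑ d ∈ Finset.univ.image D, prob p {ω | A ω = a} * prob p {ω | B ω = b} *
          prob p {ω | C ω = c} * prob p {ω | D ω = d} := by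
          refine Finset.sum_congr rfl fun d _ => ?_
          rw [← h]
          congr 1
          ext ω
          simp only [Set.mem_ofPred_eq, and_assoc]
      _ = _ := by rw [← Finset.mul_sum, one D, mul_one]
  simp only [this]
  rw [← Finset.mul_sum, one C, mul_one]

lemma ent_congr_pair {Ω R S : Type*} [Fintype Ω] {p : Ω → ℝ} {A B C D : Ω → R} (f : R → R → S)
    (h : ∀ a b, prob p {ω | A ω = a ∧ B ω = b} = prob p {ω | C ω = a ∧ D ω = b}) :
    ent p (fun ω => f (A ω) (B ω)) = ent p (fun ω => f (C ω) (D ω)) := by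
  classical
  refine ent_congr_law p _ _ fun v => ?_
  let T : Finset (R × R) := Finset.univ.image (fun ω => (A ω, B ω)) ∪
    Finset.univ.image (fun ω => (C ω, D ω))
  rw [← prob_marg p (fun ω => (A ω, B ω)) T
      (fun ω => Finset.mem_union_left _ (Finset.mem_image_of_mem _ (Finset.mem_univ ω))),
    ← prob_marg p (fun ω => (C ω, D ω)) T
      (fun ω => Finset.mem_union_right _ (Finset.mem_image_of_mem (fun ω => (C ω, D ω)) (Finset.mem_univ ω)))]
  refine Finset.sum_congr rfl fun x _ => ?_
  obtain ⟨a, b⟩ := x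
  by_cases hv : f a b = v
  · convert h a b using 2
    · ext ω
      simp only [Set.mem_ofPred_eq, Prod.mk.injEq]
      constructor
      · exact fun h => h.2
      · rintro ⟨rfl, rfl⟩; exact ⟨hv, rfl, rfl⟩
    · ext ω
      simp only [Set.mem_ofPred_eq, Prod.mk.injEq]
      constructor
      · exact fun h => h.2
      · rintro ⟨rfl, rfl⟩; exact ⟨hv, rfl, rfl⟩
  · congr 1
    ext ω
    simp only [Set.mem_ofPred_eq, Prod.mk.injEq]
    constructor
    · rintro ⟨h1, rfl, rfl⟩; exact absurd h1 hv
    · rintro ⟨h1, rfl, rfl⟩; exact absurd h1 hv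

lemma ent_quad {Ω R : Type*} [Fintype Ω] {p : Ω → ℝ} (hp : ∀ ω, 0 ≤ p ω) {A B C D : Ω → R}
    (h : ∀ a b c d : R, prob p {ω | A ω = a ∧ B ω = b ∧ C ω = c ∧ D ω = d} =
        prob p {ω | A ω = a} * prob p {ω | B ω = b} * prob p {ω | C ω = c} *
          prob p {ω | D ω = d}) :
    ent p (fun ω => (A ω, B ω, C ω, D ω)) = ent p A + ent p B + ent p C + ent p D := by
  simp only [ent_eq_sum, Prod.mk.injEq, h]
  rw [← neg_add, ← neg_add, ← neg_add, ← Finset.sum_add_distrib, ← Finset.sum_add_distrib,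
    ← Finset.sum_add_distrib]
  congr 1
  refine Finset.sum_congr rfl fun ω _ => ?_
  by_cases hω : p ω = 0
  · simp [hω]
  have pos : 0 < p ω := lt_of_le_of_ne (hp ω) (Ne.symm hω)
  have q : ∀ X : Ω → R, prob p {ω' | X ω' = X ω} ≠ 0 := fun X =>
    (pos.trans_le (le_prob hp {ω' | X ω' = X ω} rfl)).ne'
  rw [Real.logb_mul (mul_ne_zero (mul_ne_zero (q A) (q B)) (q C)) (q D),
    Real.logb_mul (mul_ne_zero (q A) (q B)) (q C), Real.logb_mul (q A) (q B)]
  ring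

theorem ring_plunnecke_ruzsa_sub {Ω R : Type*} [Fintype Ω] [CommRing R] [NoZeroDivisors R]
    (p : Ω → ℝ) (hp : ∀ ω, 0 ≤ p ω) (hp1 : ∑ ω, p ω = 1) (A B C D : Ω → R)
    (hA0 : prob p {ω | A ω = 0} = 0) (hB0 : prob p {ω | B ω = 0} = 0)
    (hC0 : prob p {ω | C ω = 0} = 0) (hD0 : prob p {ω | D ω = 0} = 0) :
    (ent p (fun ω => A ω * B ω - C ω * D ω) +
        ent p (fun ω => (A ω * B ω, C ω * D ω, A ω * (B ω + D ω), (A ω + C ω) * D ω)) ≤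
      ent p (fun ω => (A ω * B ω, C ω * D ω)) +
        ent p (fun ω => (A ω * (B ω + D ω), (A ω + C ω) * D ω))) ∧
    ((∀ a b c d : R, prob p {ω | A ω = a ∧ B ω = b ∧ C ω = c ∧ D ω = d} =
        prob p {ω | A ω = a} * prob p {ω | B ω = b} * prob p {ω | C ω = c} *
          prob p {ω | D ω = d}) →
      (∀ r : R, prob p {ω | B ω = r} = prob p {ω | A ω = r}) →
      (∀ r : R, prob p {ω | C ω = r} = prob p {ω | A ω = r}) →
      (∀ r : R, prob p {ω | D ω = r} = prob p {ω | A ω = r}) →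
      ent p (fun ω => A ω * B ω - C ω * D ω) ≤
        5 * ent p (fun ω => A ω * B ω) + 2 * ent p (fun ω => A ω + B ω) - 6 * ent p A) := by
  constructor
  · rw [add_comm]
    refine submod hp hp1 _ _ _ _ ?_ ?_ ?_
    · intro ω ω' _ _ h
      simp only [Prod.mk.injEq] at h
      rw [h.1, h.2]
    · intro ω ω' _ _ h
      simp only [Prod.mk.injEq] at h
      linear_combination h.1 - h.2
    · intro ω ω' _ _ h h'
      simp only [Prod.mk.injEq] at h h' ⊢
      exact ⟨h.1, h.2, h'.1, h'.2⟩
  intro hq hB hC hD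
  have nz : ∀ ω, p ω ≠ 0 → A ω ≠ 0 := by
    intro ω hω h
    have := le_prob hp {ω | A ω = 0} (ω := ω) h
    exact hω (le_antisymm (this.trans hA0.le) (hp ω))
  have eB := ent_congr_law p B A hB
  have eC := ent_congr_law p C A hC
  have eD := ent_congr_law p D A hD
  have lAB : ∀ a b, prob p {ω | A ω = a ∧ B ω = b} = prob p {ω | A ω = a} * prob p {ω | A ω = b} :=
    fun a b => by rw [pair_law hp1 hq, hB]
  have lAD : ∀ a b, prob p {ω | A ω = a ∧ D ω = b} = prob p {ω | A ω = a} * prob p {ω | A ω = b} := by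
    intro a b
    rw [pair_law (C := B) (D := C) hp1 ?_, hD]
    intro a d b c
    have := hq a b c d
    rw [show {ω | A ω = a ∧ D ω = d ∧ B ω = b ∧ C ω = c} =
      {ω | A ω = a ∧ B ω = b ∧ C ω = c ∧ D ω = d} by ext ω; simp only [Set.mem_ofPred_eq]; tauto, this]
    ring
  have lCD : ∀ a b, prob p {ω | C ω = a ∧ D ω = b} = prob p {ω | A ω = a} * prob p {ω | A ω = b} := by
    intro a b
    rw [pair_law (C := A) (D := B) hp1 ?_, hD, hC]
    intro c d a b
    have := hq a b c d
    rw [show {ω | C ω = c ∧ D ω = d ∧ A ω = a ∧ B ω = b} =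
      {ω | A ω = a ∧ B ω = b ∧ C ω = c ∧ D ω = d} by ext ω; simp only [Set.mem_ofPred_eq]; tauto, this]
    ring
  have lBD : ∀ a b, prob p {ω | B ω = a ∧ D ω = b} = prob p {ω | A ω = a} * prob p {ω | A ω = b} := by
    intro a b
    rw [pair_law (C := A) (D := C) hp1 ?_, hD, hB]
    intro b d a c
    have := hq a b c d
    rw [show {ω | B ω = b ∧ D ω = d ∧ A ω = a ∧ C ω = c} =
      {ω | A ω = a ∧ B ω = b ∧ C ω = c ∧ D ω = d} by ext ω; simp only [Set.mem_ofPred_eq]; tauto, this]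
    ring
  have lAC : ∀ a b, prob p {ω | A ω = a ∧ C ω = b} = prob p {ω | A ω = a} * prob p {ω | A ω = b} := by
    intro a b
    rw [pair_law (C := B) (D := D) hp1 ?_, hC]
    intro a c b d
    have := hq a b c d
    rw [show {ω | A ω = a ∧ C ω = c ∧ B ω = b ∧ D ω = d} =
      {ω | A ω = a ∧ B ω = b ∧ C ω = c ∧ D ω = d} by ext ω; simp only [Set.mem_ofPred_eq]; tauto, this]
    ring
  have mCD : ent p (fun ω => C ω * D ω) = ent p (fun ω => A ω * B ω) :=
    ent_congr_pair (fun x y => x * y) fun a b => by rw [lCD, lAB]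
  have mAD : ent p (fun ω => A ω * D ω) = ent p (fun ω => A ω * B ω) :=
    ent_congr_pair (fun x y => x * y) fun a b => by rw [lAD, lAB]
  have sBD : ent p (fun ω => B ω + D ω) = ent p (fun ω => A ω + B ω) :=
    ent_congr_pair (fun x y => x + y) fun a b => by rw [lBD, lAB]
  have sAC : ent p (fun ω => A ω + C ω) = ent p (fun ω => A ω + B ω) :=
    ent_congr_pair (fun x y => x + y) fun a b => by rw [lAC, lAB]
  have h4 := ent_quad hp hq
  -- (1)
  have i1 : ent p (fun ω => (A ω * B ω, C ω * D ω, A ω * D ω)) +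
      ent p (fun ω => A ω * B ω - C ω * D ω) ≤ ent p (fun ω => (A ω * B ω, C ω * D ω)) +
        ent p (fun ω => (A ω * (B ω + D ω), (A ω + C ω) * D ω)) := by
    refine submod hp hp1 _ _ _ _ ?_ ?_ ?_
    · intro ω ω' _ _ h
      simp only [Prod.mk.injEq] at h
      rw [h.1, h.2]
    · intro ω ω' _ _ h
      simp only [Prod.mk.injEq] at h
      linear_combination h.1 - h.2
    · intro ω ω' _ _ h h'
      simp only [Prod.mk.injEq] at h h' ⊢
      exact ⟨h.1, h.2, by linear_combination h'.1 - h.1⟩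
  have i2 : ent p (fun ω => (A ω * B ω, C ω * D ω)) ≤
      ent p (fun ω => A ω * B ω) + ent p (fun ω => C ω * D ω) :=
    subadd hp hp1 _ _ _ fun ω ω' _ _ h h' => Prod.ext h h'
  have i3 : ent p (fun ω => (A ω * (B ω + D ω), (A ω + C ω) * D ω)) ≤
      ent p (fun ω => A ω * (B ω + D ω)) + ent p (fun ω => (A ω + C ω) * D ω) :=
    subadd hp hp1 _ _ _ fun ω ω' _ _ h h' => Prod.ext h h'
  have i4 : ent p (fun ω => (A ω, B ω, D ω)) + ent p (fun ω => A ω * (B ω + D ω)) ≤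
      ent p (fun ω => (A ω * B ω, A ω * D ω)) + ent p (fun ω => (A ω, B ω + D ω)) := by
    refine submod hp hp1 _ _ _ _ ?_ ?_ ?_
    · intro ω ω' _ _ h
      simp only [Prod.mk.injEq] at h
      linear_combination h.1 + h.2
    · intro ω ω' _ _ h
      simp only [Prod.mk.injEq] at h
      rw [h.1, h.2]
    · intro ω ω' hω _ h h'
      simp only [Prod.mk.injEq] at h h' ⊢
      obtain ⟨h1, h2⟩ := h
      rw [← h'.1] at h1 h2
      exact ⟨h'.1, mul_left_cancel₀ (nz ω hω) h1, mul_left_cancel₀ (nz ω hω) h2⟩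
  have i4' : ent p (fun ω => (A ω, B ω + D ω)) ≤ ent p A + ent p (fun ω => B ω + D ω) :=
    subadd hp hp1 _ _ _ fun ω ω' _ _ h h' => Prod.ext h h'
  have nzD : ∀ ω, p ω ≠ 0 → D ω ≠ 0 := by
    intro ω hω h
    have := le_prob hp {ω | D ω = 0} (ω := ω) h
    exact hω (le_antisymm (this.trans hD0.le) (hp ω))
  have i5 : ent p (fun ω => (A ω, C ω, D ω)) + ent p (fun ω => (A ω + C ω) * D ω) ≤
      ent p (fun ω => (A ω * D ω, C ω * D ω)) + ent p (fun ω => (D ω, A ω + C ω)) := by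
    refine submod hp hp1 _ _ _ _ ?_ ?_ ?_
    · intro ω ω' _ _ h
      simp only [Prod.mk.injEq] at h
      linear_combination h.1 + h.2
    · intro ω ω' _ _ h
      simp only [Prod.mk.injEq] at h
      rw [h.1, h.2]
    · intro ω ω' hω _ h h'
      simp only [Prod.mk.injEq] at h h' ⊢
      obtain ⟨h1, h2⟩ := h
      rw [← h'.1] at h1 h2
      exact ⟨mul_right_cancel₀ (nzD ω hω) h1, mul_right_cancel₀ (nzD ω hω) h2, h'.1⟩
  have i5' : ent p (fun ω => (D ω, A ω + C ω)) ≤ ent p D + ent p (fun ω => A ω + C ω) :=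
    subadd hp hp1 _ _ _ fun ω ω' _ _ h h' => Prod.ext h h'
  have i6 : ent p (fun ω => (A ω * B ω, A ω * D ω)) ≤
      ent p (fun ω => A ω * B ω) + ent p (fun ω => A ω * D ω) :=
    subadd hp hp1 _ _ _ fun ω ω' _ _ h h' => Prod.ext h h'
  have i7 : ent p (fun ω => (A ω, B ω, C ω, D ω)) + ent p (fun ω => (A ω * D ω, C ω * D ω)) ≤
      ent p (fun ω => (A ω * B ω, C ω * D ω, A ω * D ω)) + ent p (fun ω => (A ω, C ω, D ω)) := by
    refine submod hp hp1 _ _ _ _ ?_ ?_ ?_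
    · intro ω ω' _ _ h
      simp only [Prod.mk.injEq] at h ⊢
      exact ⟨h.2.2, h.2.1⟩
    · intro ω ω' _ _ h
      simp only [Prod.mk.injEq] at h
      rw [h.1, h.2.1, h.2.2]
    · intro ω ω' hω _ h h'
      simp only [Prod.mk.injEq] at h h' ⊢
      obtain ⟨h1, -⟩ := h
      rw [← h'.1] at h1
      exact ⟨h'.1, mul_left_cancel₀ (nz ω hω) h1, h'.2.1, h'.2.2⟩
  have i8 : ent p (fun ω => (A ω, B ω, C ω, D ω)) ≤ ent p (fun ω => (A ω, B ω, D ω)) + ent p C := by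
    refine subadd hp hp1 _ _ _ fun ω ω' _ _ h h' => ?_
    simp only [Prod.mk.injEq] at h ⊢
    exact ⟨h.1, h.2.1, h', h.2.2⟩
  have i10 : ent p (fun ω => (A ω, C ω)) ≤ ent p A + ent p C :=
    subadd hp hp1 _ _ _ fun ω ω' _ _ h h' => Prod.ext h h'
  have i11 : ent p (fun ω => (A ω, C ω, D ω)) ≤ ent p (fun ω => (A ω, C ω)) + ent p D := by
    refine subadd hp hp1 _ _ _ fun ω ω' _ _ h h' => ?_
    simp only [Prod.mk.injEq] at h ⊢
    exact ⟨h.1, h.2, h'⟩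
  have i12 : ent p (fun ω => (A ω, B ω, C ω, D ω)) ≤ ent p (fun ω => (A ω, C ω, D ω)) +
      ent p (fun ω => A ω * B ω) := by
    refine subadd hp hp1 _ _ _ fun ω ω' hω _ h h' => ?_
    simp only [Prod.mk.injEq] at h h' ⊢
    rw [← h.1] at h'
    exact ⟨h.1, mul_left_cancel₀ (nz ω hω) h', h.2.1, h.2.2⟩
  linarith
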